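/- Let s ≥ 0 and let (a_ε)_{ε∈(0,1]} be a family of smooth real-valued functions on ℝ satisfying the local Zygmund estimates of order s on ℝ, and assume there are constants 0 < c₁ ≤ c₂ with c₁ ≤ a_ε(x) ≤ c₂ for all x ∈ ℝ and all ε ∈ (0,1]. Let t ∈ ℝ and let (b_ε)_{ε∈(0,1]} be a family of smooth functions on ℝ satisfying the local Zygmund estimates of order t on ℝ. Define A_ε(x) = ∫₀^x dy/a_ε(y), which is a smooth strictly increasing bijection of ℝ onto ℝ, and set u_ε(x,τ) = b_ε(A_ε^{−1}(A_ε(x) − τ)). Then each u_ε is a smooth solution of ∂_τ u_ε + a_ε(x) ∂_x u_ε = 0 with u_ε(x,0) = b_ε(x), and the family (u_ε)_{ε∈(0,1]} satisfies the local Zygmund estimates on ℝ² of order min(t, s+1) if s > 0, and of order min(t,1) − σ for every σ > 0 if s = 0. -/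

import Mathlib

open MeasureTheory SchwartzMap Filter
open scoped FourierTransform Topology

noncomputable section

/-- A family `(u_ε)` of functions on `ℝ` satisfies the local Zygmund estimates of order `s`
(on `Ω = ℝ`): for every compact `K` and every derivative order `k`, as `ε → 0⁺`,
`sup_{x ∈ K} ‖u_ε^{(k)}(x)‖` is `O(1)` for `k < s`, `O(log(1/ε))` for `k = s` and
`O(ε^{s-k})` for `k > s`. -/
def ZygLoc1 {F : Type*} [NormedAddCommGroup F] [NormedSpace ℝ F]
    (s : ℝ) (u : ℝ → ℝ → F) : Prop :=
  ∀ K : Set ℝ, IsCompact K → ∀ k : ℕ,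
    (((k : ℕ) : ℝ) < s →
      ∃ C, ∀ᶠ ε in 𝓝[>] (0:ℝ), ∀ x ∈ K, ‖iteratedDeriv k (u ε) x‖ ≤ C) ∧
    ((((k : ℕ) : ℝ) = s →
      ∃ C, ∀ᶠ ε in 𝓝[>] (0:ℝ), ∀ x ∈ K, ‖iteratedDeriv k (u ε) x‖ ≤ C * Real.log (1/ε))) ∧
    (s < ((k : ℕ) : ℝ) →
      ∃ C, ∀ᶠ ε in 𝓝[>] (0:ℝ), ∀ x ∈ K, ‖iteratedDeriv k (u ε) x‖ ≤ C * ε ^ (s - (k : ℕ)))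

/-- Directional derivative of a function on `ℝ²`. -/
def pd2 (v : ℝ × ℝ) (f : ℝ × ℝ → ℝ) : ℝ × ℝ → ℝ := fun p => fderiv ℝ f p v

/-- The iterated partial derivative `∂_x^{α.1} ∂_t^{α.2}` on `ℝ²`. -/
def mderiv2 (α : ℕ × ℕ) (f : ℝ × ℝ → ℝ) : ℝ × ℝ → ℝ :=
  (pd2 (1, 0))^[α.1] ((pd2 (0, 1))^[α.2] f)

/-- A family `(u_ε)` of functions on `ℝ²` satisfies the local Zygmund estimates of order `s`
(on `Ω = ℝ²`). -/
def ZygLoc2 (s : ℝ) (u : ℝ → ℝ × ℝ → ℝ) : Prop :=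
  ∀ K : Set (ℝ × ℝ), IsCompact K → ∀ α : ℕ × ℕ,
    (((α.1 + α.2 : ℕ) : ℝ) < s →
      ∃ C, ∀ᶠ ε in 𝓝[>] (0:ℝ), ∀ x ∈ K, |mderiv2 α (u ε) x| ≤ C) ∧
    ((((α.1 + α.2 : ℕ) : ℝ) = s →
      ∃ C, ∀ᶠ ε in 𝓝[>] (0:ℝ), ∀ x ∈ K, |mderiv2 α (u ε) x| ≤ C * Real.log (1/ε))) ∧
    (s < ((α.1 + α.2 : ℕ) : ℝ) →
      ∃ C, ∀ᶠ ε in 𝓝[>] (0:ℝ), ∀ x ∈ K, |mderiv2 α (u ε) x| ≤ C * ε ^ (s - (α.1 + α.2 : ℕ)))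

/-- `A_ε(x) = ∫₀ˣ dy / a_ε(y)`. -/
def Afam (a : ℝ → ℝ → ℝ) (ε : ℝ) : ℝ → ℝ := fun x => ∫ y in (0:ℝ)..x, (a ε y)⁻¹

/-- The solution family `u_ε(x,τ) = b_ε(A_ε⁻¹(A_ε(x) - τ))` of the hyperbolic Cauchy
problem, by characteristics. -/
def ufam (a b : ℝ → ℝ → ℝ) (ε : ℝ) : ℝ × ℝ → ℝ :=
  fun p => b ε (Function.invFun (Afam a ε) (Afam a ε p.1 - p.2))

/-! ### Scales of bounds -/

def phi (t : ℝ) (k : ℕ) (ε : ℝ) : ℝ :=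
  if (k : ℝ) < t then 1 else if (k : ℝ) = t then Real.log (1/ε) else ε ^ (t - k)

def psi (s : ℝ) (k : ℕ) : ℝ → ℝ := if k = 0 then fun _ => 1 else phi s k

lemma phi_lt {t : ℝ} {k : ℕ} (h : (k : ℝ) < t) : phi t k = fun _ => 1 := by
  funext ε; simp [phi, h]

lemma phi_eq {t : ℝ} {k : ℕ} (h : (k : ℝ) = t) : phi t k = fun ε => Real.log (1/ε) := by
  funext ε; simp [phi, h]

lemma phi_gt {t : ℝ} {k : ℕ} (h : t < (k : ℝ)) : phi t k = fun ε => ε ^ (t - k) := by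
  funext ε; simp [phi, h.le, h.ne']

lemma log_bigO {e : ℝ} (he : 0 < e) :
    (fun ε : ℝ => Real.log (1/ε)) =O[𝓝[>] (0:ℝ)] fun ε => ε ^ (-e) := by
  have h := (isLittleO_log_rpow_atTop he).isBigO.comp_tendsto tendsto_inv_nhdsGT_zero
  refine (h.congr_left ?_).congr' EventuallyEq.rfl ?_
  · intro ε; simp
  · filter_upwards [self_mem_nhdsWithin] with ε hε
    simp only [Function.comp]
    rw [Real.inv_rpow (le_of_lt hε), Real.rpow_neg (le_of_lt hε)]

lemma one_bigO_log :
    (fun _ : ℝ => (1:ℝ)) =O[𝓝[>] (0:ℝ)] fun ε => Real.log (1/ε) := by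
  have h : Tendsto (fun ε : ℝ => Real.log (1/ε)) (𝓝[>] 0) atTop := by
    simpa [Function.comp_def] using Real.tendsto_log_atTop.comp (tendsto_inv_nhdsGT_zero (𝕜 := ℝ))
  refine Asymptotics.IsBigO.of_bound 1 ?_
  filter_upwards [h.eventually_ge_atTop 1] with ε hε
  rw [one_mul, norm_one, Real.norm_eq_abs]
  exact hε.trans (le_abs_self _)

lemma rpow_bigO {e f : ℝ} (h : e ≤ f) :
    (fun ε : ℝ => ε ^ (-e)) =O[𝓝[>] (0:ℝ)] fun ε => ε ^ (-f) := by
  refine Asymptotics.IsBigO.of_bound 1 ?_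
  filter_upwards [Ioo_mem_nhdsGT (zero_lt_one' ℝ)] with ε hε
  rw [one_mul, Real.norm_of_nonneg (Real.rpow_nonneg hε.1.le _),
    Real.norm_of_nonneg (Real.rpow_nonneg hε.1.le _)]
  exact Real.rpow_le_rpow_of_exponent_ge hε.1 hε.2.le (by linarith)

lemma phi_bigO_rpow {t : ℝ} {k : ℕ} {e : ℝ} (h0 : 0 ≤ e) (h1 : (k:ℝ) - t ≤ e)
    (h2 : (k:ℝ) = t → 0 < e) : phi t k =O[𝓝[>] (0:ℝ)] fun ε => ε ^ (-e) := by
  rcases lt_trichotomy (k:ℝ) t with h | h | h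
  · rw [phi_lt h]
    simpa using rpow_bigO h0
  · rw [phi_eq h]; exact log_bigO (h2 h)
  · rw [phi_gt h]
    have := rpow_bigO h1
    simpa using this

lemma phi_mono {r t : ℝ} (k : ℕ) (h : r ≤ t) : phi t k =O[𝓝[>] (0:ℝ)] phi r k := by
  rcases lt_trichotomy (k:ℝ) r with h' | h' | h'
  · rw [phi_lt h', phi_lt (h'.trans_le h)]
  · rcases h.eq_or_lt with rfl | h
    · exact Asymptotics.isBigO_refl _ _
    · rw [phi_eq h', phi_lt (h' ▸ h)]; exact one_bigO_log
  · rw [phi_gt h']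
    have := phi_bigO_rpow (t := t) (k := k) (e := k - r) (by linarith) (by linarith)
      (fun _ => by linarith)
    simpa using this

lemma mul_bigO {f g : ℝ → ℝ} {r : ℝ} {N : ℕ} (e1 e2 : ℝ)
    (hf : f =O[𝓝[>] (0:ℝ)] fun ε => ε ^ (-e1)) (hg : g =O[𝓝[>] (0:ℝ)] fun ε => ε ^ (-e2))
    (hr : r < N) (he : e1 + e2 = N - r) :
    (fun ε => f ε * g ε) =O[𝓝[>] (0:ℝ)] phi r N := by
  rw [phi_gt hr]
  refine (hf.mul hg).congr' EventuallyEq.rfl ?_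
  filter_upwards [self_mem_nhdsWithin] with ε hε
  rw [← Real.rpow_add hε]
  congr 1; linarith

lemma psi_mul {s : ℝ} (hs : 0 ≤ s) (k l : ℕ) :
    (fun ε => psi s k ε * psi s l ε) =O[𝓝[>] (0:ℝ)] psi s (k + l) := by
  rcases Nat.eq_zero_or_pos k with rfl | hk
  · simp only [psi, if_true, one_mul, mul_one, zero_add, add_zero]; exact Asymptotics.isBigO_refl _ _
  rcases Nat.eq_zero_or_pos l with rfl | hl
  · simp only [psi, if_true, one_mul, mul_one, zero_add, add_zero]; exact Asymptotics.isBigO_refl _ _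
  have e : ∀ m, 0 < m → psi s m = phi s m := fun m hm => by simp [psi, hm.ne']
  rw [e k hk, e l hl, e _ (by omega)]
  have hk' : (1:ℝ) ≤ k := by exact_mod_cast hk
  have hl' : (1:ℝ) ≤ l := by exact_mod_cast hl
  have hc : ((k + l : ℕ) : ℝ) = k + l := by push_cast; ring
  rcases lt_trichotomy ((k + l : ℕ) : ℝ) s with h | h | h
  · rw [phi_lt h, phi_lt (show (k:ℝ) < s by linarith), phi_lt (show (l:ℝ) < s by linarith)]
    simpa using Asymptotics.isBigO_refl (fun _ : ℝ => (1:ℝ)) (𝓝[>] (0:ℝ))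
  · rw [phi_eq h, phi_lt (show (k:ℝ) < s by linarith), phi_lt (show (l:ℝ) < s by linarith)]
    simpa using one_bigO_log
  · have E : ∀ (m : ℕ) (e : ℝ), 0 ≤ e → (m:ℝ) - s ≤ e → ((m:ℝ) = s → 0 < e) → _ :=
      fun m e h0 h1 h2 => phi_bigO_rpow (t := s) (k := m) (e := e) h0 h1 h2
    rcases lt_or_ge (k:ℝ) s with a | a <;> rcases lt_or_ge (l:ℝ) s with b | b
    · exact mul_bigO 0 (k + l - s) (E _ _ (by linarith) (by linarith) (fun _ => by linarith))
        (E _ _ (by linarith) (by linarith) (fun _ => by linarith)) h (by rw [hc]; ring)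
    · exact mul_bigO 0 (k + l - s) (E _ _ (by linarith) (by linarith) (fun _ => by linarith))
        (E _ _ (by linarith) (by linarith) (fun _ => by linarith)) h (by rw [hc]; ring)
    · exact mul_bigO (k + l - s) 0 (E _ _ (by linarith) (by linarith) (fun _ => by linarith))
        (E _ _ (by linarith) (by linarith) (fun _ => by linarith)) h (by rw [hc]; ring)
    · exact mul_bigO (k - s/2) (l - s/2) (E _ _ (by linarith) (by linarith) (fun _ => by linarith))
        (E _ _ (by linarith) (by linarith) (fun _ => by linarith)) h (by rw [hc]; ring)

lemma main1 {s t : ℝ} (hs : 0 < s) (j k : ℕ) (hj : 1 ≤ j) :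
    (fun ε => phi t j ε * psi s k ε) =O[𝓝[>] (0:ℝ)] phi (min t (s+1)) (j + k) := by
  have hrt : min t (s+1) ≤ t := min_le_left _ _
  have hrs : min t (s+1) ≤ s + 1 := min_le_right _ _
  rcases Nat.eq_zero_or_pos k with rfl | hk
  · simpa [psi] using phi_mono j hrt
  have e : psi s k = phi s k := by simp [psi, hk.ne']
  rw [e]
  have hj' : (1:ℝ) ≤ j := by exact_mod_cast hj
  have hk' : (1:ℝ) ≤ k := by exact_mod_cast hk
  have hc : ((j + k : ℕ) : ℝ) = j + k := by push_cast; ring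
  generalize min t (s+1) = r at *
  rcases lt_trichotomy ((j + k : ℕ) : ℝ) r with h | h | h
  · rw [phi_lt h, phi_lt (show (k:ℝ) < s by linarith), phi_lt (show (j:ℝ) < t by linarith)]
    simpa using Asymptotics.isBigO_refl (fun _ : ℝ => (1:ℝ)) (𝓝[>] (0:ℝ))
  · rw [phi_eq h, phi_lt (show (j:ℝ) < t by linarith)]
    rcases (show (k:ℝ) ≤ s by linarith).eq_or_lt with h' | h'
    · rw [phi_eq h']; simp only [one_mul]; exact Asymptotics.isBigO_refl _ _
    · rw [phi_lt h']; simpa using one_bigO_log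
  · have E : ∀ (s : ℝ) (m : ℕ) (e : ℝ), 0 ≤ e → (m:ℝ) - s ≤ e → ((m:ℝ) = s → 0 < e) → _ :=
      fun s m e h0 h1 h2 => phi_bigO_rpow (t := s) (k := m) (e := e) h0 h1 h2
    rcases lt_or_ge (k:ℝ) s with a | a
    · exact mul_bigO (j + k - r) 0 (E _ _ _ (by linarith) (by linarith) (fun _ => by linarith))
        (E _ _ _ (by linarith) (by linarith) (fun _ => by linarith)) h (by rw [hc]; ring)
    · rcases lt_or_ge (j:ℝ) t with b | b
      · exact mul_bigO 0 (j + k - r) (E _ _ _ (by linarith) (by linarith) (fun _ => by linarith))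
          (E _ _ _ (by linarith) (by linarith) (fun _ => by linarith)) h (by rw [hc]; ring)
      · exact mul_bigO (j - t + s/2) (k - s/2 + (t - r)) (E _ _ _ (by linarith) (by linarith) (fun _ => by linarith))
          (E _ _ _ (by linarith) (by linarith) (fun _ => by linarith)) h (by rw [hc]; ring)

lemma main2 {t σ : ℝ} (hσ : 0 < σ) (j k : ℕ) (hj : 1 ≤ j) :
    (fun ε => phi t j ε * psi 0 k ε) =O[𝓝[>] (0:ℝ)] phi (min t 1 - σ) (j + k) := by
  have hrt : min t 1 ≤ t := min_le_left _ _
  have hrs : min t 1 ≤ 1 := min_le_right _ _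
  have hj' : (1:ℝ) ≤ j := by exact_mod_cast hj
  have hc : ((j + k : ℕ) : ℝ) = j + k := by push_cast; ring
  have hk0 : (0:ℝ) ≤ k := k.cast_nonneg
  generalize min t 1 = r at *
  refine mul_bigO (j - (r - σ)) k
    (phi_bigO_rpow (by linarith) (by linarith) (fun _ => by linarith)) ?_
    (by rw [hc]; linarith) (by rw [hc]; ring)
  rcases Nat.eq_zero_or_pos k with rfl | hk
  · simpa [psi] using Asymptotics.isBigO_refl (fun _ : ℝ => (1:ℝ)) (𝓝[>] (0:ℝ))
  · have hk' : (1:ℝ) ≤ k := by exact_mod_cast hk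
    have e : psi 0 k = phi 0 k := by simp [psi, hk.ne']
    rw [e]
    exact phi_bigO_rpow (by linarith) (by linarith) (fun _ => by linarith)

/-! ### The characteristic flow -/

def Yf (a : ℝ → ℝ → ℝ) (ε : ℝ) (p : ℝ × ℝ) : ℝ :=
  Function.invFun (Afam a ε) (Afam a ε p.1 - p.2)

lemma A_deriv {a : ℝ → ℝ → ℝ} {ε : ℝ} (ha : ContDiff ℝ (⊤ : ℕ∞) (a ε)) {c₁ : ℝ} (hc₁ : 0 < c₁)
    (h1 : ∀ x, c₁ ≤ a ε x) (x : ℝ) : HasDerivAt (Afam a ε) (a ε x)⁻¹ x := by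
  have hc : Continuous fun y => (a ε y)⁻¹ :=
    ha.continuous.inv₀ fun y => (hc₁.trans_le (h1 y)).ne'
  exact intervalIntegral.integral_hasDerivAt_right (hc.intervalIntegrable _ _)
    (hc.stronglyMeasurableAtFilter _ _) hc.continuousAt

lemma A_smooth {a : ℝ → ℝ → ℝ} {ε : ℝ} (ha : ContDiff ℝ (⊤ : ℕ∞) (a ε)) {c₁ : ℝ} (hc₁ : 0 < c₁)
    (h1 : ∀ x, c₁ ≤ a ε x) : ContDiff ℝ (⊤ : ℕ∞) (Afam a ε) := by
  have hd := A_deriv ha hc₁ h1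
  rw [contDiff_infty_iff_deriv]
  refine ⟨fun x => (hd x).differentiableAt, ?_⟩
  rw [show deriv (Afam a ε) = fun x => (a ε x)⁻¹ from funext fun x => (hd x).deriv]
  exact ha.inv fun y => (hc₁.trans_le (h1 y)).ne'

lemma A_expand {a : ℝ → ℝ → ℝ} {ε : ℝ} (ha : ContDiff ℝ (⊤ : ℕ∞) (a ε)) {c₁ c₂ : ℝ} (hc₁ : 0 < c₁)
    (h1 : ∀ x, c₁ ≤ a ε x ∧ a ε x ≤ c₂) {x y : ℝ} (hxy : x ≤ y) :
    c₂⁻¹ * (y - x) ≤ Afam a ε y - Afam a ε x := by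
  have hd := A_deriv ha hc₁ (fun x => (h1 x).1)
  refine mul_sub_le_image_sub_of_le_deriv (fun x => (hd x).differentiableAt) (fun x => ?_) hxy
  rw [(hd x).deriv]
  exact inv_anti₀ (hc₁.trans_le (h1 x).1) (h1 x).2

lemma A_strict {a : ℝ → ℝ → ℝ} {ε : ℝ} (ha : ContDiff ℝ (⊤ : ℕ∞) (a ε)) {c₁ c₂ : ℝ} (hc₁ : 0 < c₁)
    (hc₂ : 0 < c₂) (h1 : ∀ x, c₁ ≤ a ε x ∧ a ε x ≤ c₂) : StrictMono (Afam a ε) := by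
  intro x y h
  have := A_expand ha hc₁ h1 h.le
  have : 0 < c₂⁻¹ * (y - x) := mul_pos (inv_pos.2 hc₂) (sub_pos.2 h)
  linarith

lemma A_bij {a : ℝ → ℝ → ℝ} {ε : ℝ} (ha : ContDiff ℝ (⊤ : ℕ∞) (a ε)) {c₁ c₂ : ℝ} (hc₁ : 0 < c₁)
    (hc₂ : 0 < c₂) (h1 : ∀ x, c₁ ≤ a ε x ∧ a ε x ≤ c₂) : Function.Bijective (Afam a ε) := by
  refine ⟨(A_strict ha hc₁ hc₂ h1).injective, ?_⟩
  have h0 : Afam a ε 0 = 0 := by simp [Afam]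
  have hp : 0 < c₂⁻¹ := inv_pos.2 hc₂
  refine (A_smooth ha hc₁ (fun x => (h1 x).1)).continuous.surjective ?_ ?_
  · refine tendsto_atTop_mono' _ ?_ (tendsto_id.const_mul_atTop hp)
    filter_upwards [eventually_ge_atTop 0] with x hx
    have := A_expand ha hc₁ h1 hx
    simpa [h0] using this
  · refine tendsto_atBot_mono' _ ?_ (tendsto_id.const_mul_atBot hp)
    filter_upwards [eventually_le_atBot 0] with x hx
    have := A_expand ha hc₁ h1 hx
    simp only [id]
    linarith

lemma inv_lip {a : ℝ → ℝ → ℝ} {ε : ℝ} (ha : ContDiff ℝ (⊤ : ℕ∞) (a ε)) {c₁ c₂ : ℝ} (hc₁ : 0 < c₁)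
    (hc₂ : 0 < c₂) (h1 : ∀ x, c₁ ≤ a ε x ∧ a ε x ≤ c₂) (x y : ℝ) :
    |x - y| ≤ c₂ * |Afam a ε x - Afam a ε y| := by
  wlog h : y ≤ x generalizing x y
  · rw [abs_sub_comm, abs_sub_comm (Afam a ε x)]; exact this y x (le_of_not_ge h)
  have := A_expand ha hc₁ h1 h
  rw [inv_mul_le_iff₀ hc₂] at this
  rw [abs_of_nonneg (sub_nonneg.2 h)]
  exact this.trans (mul_le_mul_of_nonneg_left (le_abs_self _) hc₂.le)

lemma Y_near {a : ℝ → ℝ → ℝ} {ε : ℝ} (ha : ContDiff ℝ (⊤ : ℕ∞) (a ε)) {c₁ c₂ : ℝ} (hc₁ : 0 < c₁)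
    (hc₂ : 0 < c₂) (h1 : ∀ x, c₁ ≤ a ε x ∧ a ε x ≤ c₂) (p : ℝ × ℝ) :
    |Yf a ε p - p.1| ≤ c₂ * |p.2| := by
  have := inv_lip ha hc₁ hc₂ h1 (Yf a ε p) p.1
  rwa [Yf, Function.rightInverse_invFun (A_bij ha hc₁ hc₂ h1).2, sub_sub_cancel_left, abs_neg] at this

lemma inv_deriv {a : ℝ → ℝ → ℝ} {ε : ℝ} (ha : ContDiff ℝ (⊤ : ℕ∞) (a ε)) {c₁ c₂ : ℝ} (hc₁ : 0 < c₁)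
    (hc₂ : 0 < c₂) (h1 : ∀ x, c₁ ≤ a ε x ∧ a ε x ≤ c₂) (y : ℝ) :
    HasDerivAt (Function.invFun (Afam a ε)) (a ε (Function.invFun (Afam a ε) y)) y := by
  have hr := Function.rightInverse_invFun (A_bij ha hc₁ hc₂ h1).2
  have hc : Continuous (Function.invFun (Afam a ε)) := by
    have : LipschitzWith ⟨c₂, hc₂.le⟩ (Function.invFun (Afam a ε)) := by
      refine LipschitzWith.of_dist_le_mul fun x y => ?_
      have := inv_lip ha hc₁ hc₂ h1 (Function.invFun (Afam a ε) x) (Function.invFun (Afam a ε) y)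
      rwa [hr, hr] at this
    exact this.continuous
  have hpos := hc₁.trans_le (h1 (Function.invFun (Afam a ε) y)).1
  have := HasDerivAt.of_local_left_inverse hc.continuousAt
    (A_deriv ha hc₁ (fun x => (h1 x).1) (Function.invFun (Afam a ε) y)) (inv_ne_zero hpos.ne')
    (Eventually.of_forall hr)
  simpa using this

lemma inv_smooth {a : ℝ → ℝ → ℝ} {ε : ℝ} (ha : ContDiff ℝ (⊤ : ℕ∞) (a ε)) {c₁ c₂ : ℝ} (hc₁ : 0 < c₁)
    (hc₂ : 0 < c₂) (h1 : ∀ x, c₁ ≤ a ε x ∧ a ε x ≤ c₂) :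
    ContDiff ℝ (⊤ : ℕ∞) (Function.invFun (Afam a ε)) := by
  have hd := inv_deriv ha hc₁ hc₂ h1
  have hdiff : Differentiable ℝ (Function.invFun (Afam a ε)) := fun y => (hd y).differentiableAt
  rw [contDiff_infty]
  intro n
  induction n with
  | zero => exact contDiff_zero.2 hdiff.continuous
  | succ n ih =>
    push_cast
    rw [contDiff_succ_iff_deriv]
    refine ⟨hdiff, by simp, ?_⟩
    rw [show deriv (Function.invFun (Afam a ε)) = fun y => a ε (Function.invFun (Afam a ε) y) from
      funext fun x => (hd x).deriv]
    exact (contDiff_infty.1 ha n).comp ih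

lemma Y_smooth {a : ℝ → ℝ → ℝ} {ε : ℝ} (ha : ContDiff ℝ (⊤ : ℕ∞) (a ε)) {c₁ c₂ : ℝ} (hc₁ : 0 < c₁)
    (hc₂ : 0 < c₂) (h1 : ∀ x, c₁ ≤ a ε x ∧ a ε x ≤ c₂) : ContDiff ℝ (⊤ : ℕ∞) (Yf a ε) :=
  (inv_smooth ha hc₁ hc₂ h1).comp
    (((A_smooth ha hc₁ (fun x => (h1 x).1)).comp contDiff_fst).sub contDiff_snd)

lemma Y_deriv {a : ℝ → ℝ → ℝ} {ε : ℝ} (ha : ContDiff ℝ (⊤ : ℕ∞) (a ε)) {c₁ c₂ : ℝ} (hc₁ : 0 < c₁)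
    (hc₂ : 0 < c₂) (h1 : ∀ x, c₁ ≤ a ε x ∧ a ε x ≤ c₂) (p : ℝ × ℝ) :
    HasFDerivAt (Yf a ε) (a ε (Yf a ε p) •
      ((a ε p.1)⁻¹ • ContinuousLinearMap.fst ℝ ℝ ℝ - ContinuousLinearMap.snd ℝ ℝ ℝ)) p := by
  have hin : HasFDerivAt (fun p : ℝ × ℝ => Afam a ε p.1 - p.2)
      ((a ε p.1)⁻¹ • ContinuousLinearMap.fst ℝ ℝ ℝ - ContinuousLinearMap.snd ℝ ℝ ℝ) p :=
    ((A_deriv ha hc₁ (fun x => (h1 x).1) p.1).comp_hasFDerivAt p hasFDerivAt_fst).sub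
      hasFDerivAt_snd
  exact (inv_deriv ha hc₁ hc₂ h1 _).comp_hasFDerivAt p hin

/-! ### Classes of terms -/

def HD (v : ℝ × ℝ) (f f' : ℝ → ℝ × ℝ → ℝ) : Prop :=
  ∀ ε ∈ Set.Ioc (0:ℝ) 1, ∀ p, ∃ L : ℝ × ℝ →L[ℝ] ℝ, HasFDerivAt (f ε) L p ∧ L v = f' ε p

inductive QQ (a : ℝ → ℝ → ℝ) : ℕ → (ℝ → ℝ × ℝ → ℝ) → Prop
  | const (c : ℝ) : QQ a 0 (fun _ _ => c)
  | aY (k : ℕ) : QQ a k (fun ε p => iteratedDeriv k (a ε) (Yf a ε p))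
  | ax (k : ℕ) : QQ a k (fun ε p => iteratedDeriv k (a ε) p.1)
  | inv : QQ a 0 (fun ε p => (a ε p.1)⁻¹)
  | add {k : ℕ} {f g : ℝ → ℝ × ℝ → ℝ} (hf : QQ a k f) (hg : QQ a k g) :
      QQ a k (fun ε p => f ε p + g ε p)
  | mul {k l m : ℕ} {f g : ℝ → ℝ × ℝ → ℝ} (hf : QQ a k f) (hg : QQ a l g) (h : m = k + l) :
      QQ a m (fun ε p => f ε p * g ε p)

inductive RR (a b : ℝ → ℝ → ℝ) : ℕ → (ℝ → ℝ × ℝ → ℝ) → Prop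
  | base : RR a b 0 (fun ε p => b ε (Yf a ε p))
  | term {j k m : ℕ} {q : ℝ → ℝ × ℝ → ℝ} (hq : QQ a k q) (h : m = j + 1 + k) :
      RR a b m (fun ε p => iteratedDeriv (j + 1) (b ε) (Yf a ε p) * q ε p)
  | add {k : ℕ} {f g : ℝ → ℝ × ℝ → ℝ} (hf : RR a b k f) (hg : RR a b k g) :
      RR a b k (fun ε p => f ε p + g ε p)

lemma HD.add {v : ℝ × ℝ} {f f' g g' : ℝ → ℝ × ℝ → ℝ} (hf : HD v f f') (hg : HD v g g') :
    HD v (fun ε p => f ε p + g ε p) (fun ε p => f' ε p + g' ε p) := by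
  intro ε hε p
  obtain ⟨L, hL, e⟩ := hf ε hε p
  obtain ⟨M, hM, e'⟩ := hg ε hε p
  exact ⟨L + M, hL.add hM, by simp [e, e']⟩

lemma HD.mul {v : ℝ × ℝ} {f f' g g' : ℝ → ℝ × ℝ → ℝ} (hf : HD v f f') (hg : HD v g g') :
    HD v (fun ε p => f ε p * g ε p) (fun ε p => f' ε p * g ε p + f ε p * g' ε p) := by
  intro ε hε p
  obtain ⟨L, hL, e⟩ := hf ε hε p
  obtain ⟨M, hM, e'⟩ := hg ε hε p
  exact ⟨_, hL.mul hM, by simp [e, e']; ring⟩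

lemma iter_hasDeriv {g : ℝ → ℝ} (hg : ContDiff ℝ (⊤ : ℕ∞) g) (k : ℕ) (x : ℝ) :
    HasDerivAt (iteratedDeriv k g) (iteratedDeriv (k+1) g x) x := by
  rw [iteratedDeriv_succ]
  exact (hg.differentiable_iteratedDeriv k (by exact_mod_cast WithTop.coe_lt_top k) x).hasDerivAt

lemma HD_Y {a b : ℝ → ℝ → ℝ} (hasmooth : ∀ ε ∈ Set.Ioc (0:ℝ) 1, ContDiff ℝ (⊤ : ℕ∞) (a ε))
    {c₁ c₂ : ℝ} (hc₁ : 0 < c₁) (hc₂ : 0 < c₂)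
    (hab : ∀ ε ∈ Set.Ioc (0:ℝ) 1, ∀ x : ℝ, c₁ ≤ a ε x ∧ a ε x ≤ c₂)
    (hbsmooth : ∀ ε ∈ Set.Ioc (0:ℝ) 1, ContDiff ℝ (⊤ : ℕ∞) (b ε)) (v : ℝ × ℝ) (k : ℕ) :
    HD v (fun ε p => iteratedDeriv k (b ε) (Yf a ε p))
      (fun ε p => iteratedDeriv (k+1) (b ε) (Yf a ε p) *
        (iteratedDeriv 0 (a ε) (Yf a ε p) * ((a ε p.1)⁻¹ * v.1 + -v.2))) := by
  intro ε hε p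
  refine ⟨_, (iter_hasDeriv (hbsmooth ε hε) k _).comp_hasFDerivAt p
    (Y_deriv (hasmooth ε hε) hc₁ hc₂ (hab ε hε) p), ?_⟩
  simp; ring_nf; tauto

lemma QQ_dir (a : ℝ → ℝ → ℝ) (v : ℝ × ℝ) : QQ a 0 (fun ε p =>
    (iteratedDeriv 0 (a ε) (Yf a ε p) * ((a ε p.1)⁻¹ * v.1 + -v.2))) :=
  .mul (.aY 0) (.add (.mul .inv (.const v.1) rfl) (.const (-v.2))) rfl

lemma QQ_deriv {a : ℝ → ℝ → ℝ} (hasmooth : ∀ ε ∈ Set.Ioc (0:ℝ) 1, ContDiff ℝ (⊤ : ℕ∞) (a ε))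
    {c₁ c₂ : ℝ} (hc₁ : 0 < c₁) (hc₂ : 0 < c₂)
    (hab : ∀ ε ∈ Set.Ioc (0:ℝ) 1, ∀ x : ℝ, c₁ ≤ a ε x ∧ a ε x ≤ c₂) (v : ℝ × ℝ)
    {k : ℕ} {f : ℝ → ℝ × ℝ → ℝ} (hf : QQ a k f) :
    ∃ f', QQ a (k+1) f' ∧ HD v f f' := by
  induction hf with
  | const c =>
    refine ⟨fun ε p => 0 * iteratedDeriv 1 (a ε) p.1, .mul (.const 0) (.ax 1) rfl, ?_⟩
    intro ε hε p
    exact ⟨0, hasFDerivAt_const _ _, by simp⟩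
  | aY k =>
    exact ⟨_, .mul (.aY (k+1)) (QQ_dir a v) rfl, HD_Y hasmooth hc₁ hc₂ hab hasmooth v k⟩
  | ax k =>
    refine ⟨_, .mul (.ax (k+1)) (.const v.1) rfl, ?_⟩
    intro ε hε p
    exact ⟨_, (iter_hasDeriv (hasmooth ε hε) k _).comp_hasFDerivAt p hasFDerivAt_fst, by simp⟩
  | inv =>
    refine ⟨_, .mul (.mul (.ax 1) (.mul .inv .inv rfl) rfl) (.const (-v.1)) rfl, ?_⟩
    intro ε hε p
    have h := iter_hasDeriv (hasmooth ε hε) 0 p.1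
    rw [iteratedDeriv_zero] at h
    have hp := hc₁.trans_le (hab ε hε p.1).1
    refine ⟨_, (h.inv hp.ne').comp_hasFDerivAt p hasFDerivAt_fst, ?_⟩
    simp
    field_simp
  | add hf hg ihf ihg =>
    obtain ⟨f', hf', df⟩ := ihf
    obtain ⟨g', hg', dg⟩ := ihg
    exact ⟨_, .add hf' hg', df.add dg⟩
  | mul hf hg h ihf ihg =>
    obtain ⟨f', hf', df⟩ := ihf
    obtain ⟨g', hg', dg⟩ := ihg
    exact ⟨_, .add (.mul hf' hg (by omega)) (.mul hf hg' (by omega)), df.mul dg⟩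

lemma RR_deriv {a b : ℝ → ℝ → ℝ} (hasmooth : ∀ ε ∈ Set.Ioc (0:ℝ) 1, ContDiff ℝ (⊤ : ℕ∞) (a ε))
    {c₁ c₂ : ℝ} (hc₁ : 0 < c₁) (hc₂ : 0 < c₂)
    (hab : ∀ ε ∈ Set.Ioc (0:ℝ) 1, ∀ x : ℝ, c₁ ≤ a ε x ∧ a ε x ≤ c₂)
    (hbsmooth : ∀ ε ∈ Set.Ioc (0:ℝ) 1, ContDiff ℝ (⊤ : ℕ∞) (b ε)) (v : ℝ × ℝ)
    {k : ℕ} {f : ℝ → ℝ × ℝ → ℝ} (hf : RR a b k f) :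
    ∃ f', RR a b (k+1) f' ∧ HD v f f' := by
  induction hf with
  | base =>
    refine ⟨_, .term (j := 0) (QQ_dir a v) rfl, ?_⟩
    have := HD_Y hasmooth hc₁ hc₂ hab hbsmooth v 0
    simpa only [iteratedDeriv_zero] using this
  | @term j k m q hq h =>
    obtain ⟨q', hq', dq⟩ := QQ_deriv hasmooth hc₁ hc₂ hab v hq
    have h2 := (HD_Y hasmooth hc₁ hc₂ hab hbsmooth v (j+1)).mul dq
    simp only [mul_assoc (iteratedDeriv (j+1+1) _ _)] at h2
    exact ⟨_, .add (.term (j := j+1) (.mul (QQ_dir a v) hq rfl) (by omega))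
      (.term (j := j) hq' (by omega)), h2⟩
  | add hf hg ihf ihg =>
    obtain ⟨f', hf', df⟩ := ihf
    obtain ⟨g', hg', dg⟩ := ihg
    exact ⟨_, .add hf' hg', df.add dg⟩

lemma RR_iter {a b : ℝ → ℝ → ℝ} (hasmooth : ∀ ε ∈ Set.Ioc (0:ℝ) 1, ContDiff ℝ (⊤ : ℕ∞) (a ε))
    {c₁ c₂ : ℝ} (hc₁ : 0 < c₁) (hc₂ : 0 < c₂)
    (hab : ∀ ε ∈ Set.Ioc (0:ℝ) 1, ∀ x : ℝ, c₁ ≤ a ε x ∧ a ε x ≤ c₂)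
    (hbsmooth : ∀ ε ∈ Set.Ioc (0:ℝ) 1, ContDiff ℝ (⊤ : ℕ∞) (b ε)) (v : ℝ × ℝ)
    {k : ℕ} {f : ℝ → ℝ × ℝ → ℝ} (hf : RR a b k f) (n : ℕ) :
    ∃ g, RR a b (k+n) g ∧ ∀ ε ∈ Set.Ioc (0:ℝ) 1, (pd2 v)^[n] (f ε) = g ε := by
  induction n with
  | zero => exact ⟨f, hf, fun _ _ => rfl⟩
  | succ n ih =>
    obtain ⟨g, hg, e⟩ := ih
    obtain ⟨g', hg', d⟩ := RR_deriv hasmooth hc₁ hc₂ hab hbsmooth v hg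
    refine ⟨g', hg', fun ε hε => ?_⟩
    rw [Function.iterate_succ_apply', e ε hε]
    funext p
    obtain ⟨L, hL, e'⟩ := d ε hε p
    rw [pd2, hL.fderiv, e']

/-! ### Bounds -/

def BB (K : Set (ℝ × ℝ)) (g : ℝ → ℝ) (f : ℝ → ℝ × ℝ → ℝ) : Prop :=
  ∃ C, ∀ᶠ ε in 𝓝[>] (0:ℝ), ∀ p ∈ K, |f ε p| ≤ C * |g ε|

lemma BB.mono {K : Set (ℝ × ℝ)} {g h : ℝ → ℝ} {f : ℝ → ℝ × ℝ → ℝ} (hf : BB K g f)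
    (hgh : g =O[𝓝[>] (0:ℝ)] h) : BB K h f := by
  obtain ⟨C, hC⟩ := hf
  obtain ⟨D, hD⟩ := hgh.bound
  refine ⟨|C| * D, ?_⟩
  filter_upwards [hC, hD] with ε h1 h2 p hp
  calc |f ε p| ≤ C * |g ε| := h1 p hp
    _ ≤ |C| * |g ε| := mul_le_mul_of_nonneg_right (le_abs_self _) (abs_nonneg _)
    _ ≤ |C| * (D * |h ε|) := mul_le_mul_of_nonneg_left h2 (abs_nonneg _)
    _ = _ := by ring

lemma BB.add {K : Set (ℝ × ℝ)} {g : ℝ → ℝ} {f f' : ℝ → ℝ × ℝ → ℝ} (hf : BB K g f)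
    (hf' : BB K g f') : BB K g (fun ε p => f ε p + f' ε p) := by
  obtain ⟨C, hC⟩ := hf
  obtain ⟨D, hD⟩ := hf'
  refine ⟨C + D, ?_⟩
  filter_upwards [hC, hD] with ε h1 h2 p hp
  calc _ ≤ |f ε p| + |f' ε p| := abs_add_le _ _
    _ ≤ _ := by linarith [h1 p hp, h2 p hp]

lemma BB.mul {K : Set (ℝ × ℝ)} {g g' : ℝ → ℝ} {f f' : ℝ → ℝ × ℝ → ℝ} (hf : BB K g f)
    (hf' : BB K g' f') : BB K (fun ε => g ε * g' ε) (fun ε p => f ε p * f' ε p) := by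
  obtain ⟨C, hC⟩ := hf
  obtain ⟨D, hD⟩ := hf'
  refine ⟨C * D, ?_⟩
  filter_upwards [hC, hD] with ε h1 h2 p hp
  rw [abs_mul, abs_mul]
  calc _ ≤ (C * |g ε|) * (D * |g' ε|) :=
        mul_le_mul (h1 p hp) (h2 p hp) (abs_nonneg _) ((abs_nonneg _).trans (h1 p hp))
    _ = _ := by ring

lemma Zyg1_phi {s : ℝ} {u : ℝ → ℝ → ℝ} (hu : ZygLoc1 s u) {K : Set ℝ} (hK : IsCompact K) (k : ℕ) :
    ∃ C, ∀ᶠ ε in 𝓝[>] (0:ℝ), ∀ x ∈ K, |iteratedDeriv k (u ε) x| ≤ C * |phi s k ε| := by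
  have key : ∃ C, ∀ᶠ ε in 𝓝[>] (0:ℝ), ∀ x ∈ K, |iteratedDeriv k (u ε) x| ≤ C * phi s k ε := by
    obtain ⟨h1, h2, h3⟩ := hu K hK k
    rcases lt_trichotomy (k:ℝ) s with h | h | h
    · rw [phi_lt h]; simpa using h1 h
    · rw [phi_eq h]; simpa using h2 h
    · rw [phi_gt h]; simpa using h3 h
  obtain ⟨C, hC⟩ := key
  refine ⟨|C|, ?_⟩
  filter_upwards [hC] with ε h x hx
  exact (h x hx).trans ((le_abs_self _).trans (abs_mul _ _).le)

lemma Zyg2_of {r : ℝ} {u : ℝ → ℝ × ℝ → ℝ}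
    (h : ∀ K : Set (ℝ × ℝ), IsCompact K → ∀ α : ℕ × ℕ,
      BB K (phi r (α.1 + α.2)) (fun ε => mderiv2 α (u ε))) : ZygLoc2 r u := by
  intro K hK α
  obtain ⟨C, hC⟩ := h K hK α
  refine ⟨fun h => ⟨C, ?_⟩, fun h => ⟨C, ?_⟩, fun h => ⟨C, ?_⟩⟩
  · rw [phi_lt h] at hC; simpa using hC
  · rw [phi_eq h] at hC
    filter_upwards [hC, Ioo_mem_nhdsGT (zero_lt_one' ℝ)] with ε h1 h2 p hp
    have := h1 p hp
    rwa [abs_of_nonneg (Real.log_nonneg (by rw [le_div_iff₀ h2.1]; linarith [h2.2]))] at this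
  · rw [phi_gt h] at hC
    filter_upwards [hC, Ioo_mem_nhdsGT (zero_lt_one' ℝ)] with ε h1 h2 p hp
    have := h1 p hp
    rwa [abs_of_nonneg (Real.rpow_nonneg h2.1.le _)] at this

lemma compact_img {a : ℝ → ℝ → ℝ} (hasmooth : ∀ ε ∈ Set.Ioc (0:ℝ) 1, ContDiff ℝ (⊤ : ℕ∞) (a ε))
    {c₁ c₂ : ℝ} (hc₁ : 0 < c₁) (hc₂ : 0 < c₂)
    (hab : ∀ ε ∈ Set.Ioc (0:ℝ) 1, ∀ x : ℝ, c₁ ≤ a ε x ∧ a ε x ≤ c₂)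
    {K : Set (ℝ × ℝ)} (hK : IsCompact K) :
    ∃ K' : Set ℝ, IsCompact K' ∧ ∀ p ∈ K, p.1 ∈ K' ∧
      ∀ ε ∈ Set.Ioc (0:ℝ) 1, Yf a ε p ∈ K' := by
  obtain ⟨M, hM⟩ := hK.isBounded.exists_norm_le
  refine ⟨Set.Icc (-(M + c₂ * M)) (M + c₂ * M), isCompact_Icc, fun p hp => ?_⟩
  have h1 : |p.1| ≤ M := (norm_fst_le p).trans (hM p hp)
  have h2 : |p.2| ≤ M := (norm_snd_le p).trans (hM p hp)
  have h3 : c₂ * |p.2| ≤ c₂ * M := mul_le_mul_of_nonneg_left h2 hc₂.le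
  have h4 : 0 ≤ c₂ * |p.2| := by positivity
  rw [abs_le] at h1
  refine ⟨⟨by linarith, by linarith⟩, fun ε hε => ?_⟩
  have h5 := Y_near (hasmooth ε hε) hc₁ hc₂ (hab ε hε) p
  rw [abs_le] at h5
  exact ⟨by linarith, by linarith⟩

lemma ev_Ioc : ∀ᶠ ε in 𝓝[>] (0:ℝ), ε ∈ Set.Ioc (0:ℝ) 1 := Ioc_mem_nhdsGT zero_lt_one

lemma QQ_bound {s : ℝ} (hs : 0 ≤ s) {a : ℝ → ℝ → ℝ}
    (hasmooth : ∀ ε ∈ Set.Ioc (0:ℝ) 1, ContDiff ℝ (⊤ : ℕ∞) (a ε)) (haz : ZygLoc1 s a)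
    {c₁ c₂ : ℝ} (hc₁ : 0 < c₁) (hc₂ : 0 < c₂)
    (hab : ∀ ε ∈ Set.Ioc (0:ℝ) 1, ∀ x : ℝ, c₁ ≤ a ε x ∧ a ε x ≤ c₂)
    {K : Set (ℝ × ℝ)} (hK : IsCompact K)
    {k : ℕ} {f : ℝ → ℝ × ℝ → ℝ} (hf : QQ a k f) : BB K (psi s k) f := by
  obtain ⟨K', hK', hKK⟩ := compact_img hasmooth hc₁ hc₂ hab hK
  have key : ∀ k : ℕ, ∃ C, ∀ᶠ ε in 𝓝[>] (0:ℝ), ∀ x ∈ K',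
      |iteratedDeriv k (a ε) x| ≤ C * |psi s k ε| := by
    intro k
    rcases Nat.eq_zero_or_pos k with rfl | hk
    · refine ⟨c₂, ?_⟩
      filter_upwards [ev_Ioc] with ε hε x hx
      have := hab ε hε x
      simpa [psi, abs_of_pos (hc₁.trans_le this.1)] using this.2
    · have e : psi s k = phi s k := by simp [psi, hk.ne']
      rw [e]; exact Zyg1_phi haz hK' k
  induction hf with
  | const c => exact ⟨|c|, by simp [psi]⟩
  | aY k =>
    obtain ⟨C, hC⟩ := key k
    refine ⟨C, ?_⟩
    filter_upwards [hC, ev_Ioc] with ε h hε p hp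
    exact h _ ((hKK p hp).2 ε hε)
  | ax k =>
    obtain ⟨C, hC⟩ := key k
    refine ⟨C, ?_⟩
    filter_upwards [hC] with ε h p hp
    exact h _ (hKK p hp).1
  | inv =>
    refine ⟨c₁⁻¹, ?_⟩
    filter_upwards [ev_Ioc] with ε hε p hp
    have := (hab ε hε p.1).1
    simpa [psi, abs_of_pos (hc₁.trans_le this)] using inv_anti₀ hc₁ this
  | add hf hg ihf ihg => exact ihf.add ihg
  | mul hf hg h ihf ihg => subst h; exact (ihf.mul ihg).mono (psi_mul hs _ _)

lemma RR_bound {s t r : ℝ} (hs : 0 ≤ s) {a b : ℝ → ℝ → ℝ}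
    (hasmooth : ∀ ε ∈ Set.Ioc (0:ℝ) 1, ContDiff ℝ (⊤ : ℕ∞) (a ε)) (haz : ZygLoc1 s a)
    {c₁ c₂ : ℝ} (hc₁ : 0 < c₁) (hc₂ : 0 < c₂)
    (hab : ∀ ε ∈ Set.Ioc (0:ℝ) 1, ∀ x : ℝ, c₁ ≤ a ε x ∧ a ε x ≤ c₂)
    (hbz : ZygLoc1 t b) (hrt : r ≤ t)
    (hmain : ∀ j k : ℕ, 1 ≤ j →
      (fun ε => phi t j ε * psi s k ε) =O[𝓝[>] (0:ℝ)] phi r (j + k))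
    {K : Set (ℝ × ℝ)} (hK : IsCompact K)
    {k : ℕ} {f : ℝ → ℝ × ℝ → ℝ} (hf : RR a b k f) : BB K (phi r k) f := by
  obtain ⟨K', hK', hKK⟩ := compact_img hasmooth hc₁ hc₂ hab hK
  have key : ∀ k : ℕ, BB K (phi t k) (fun ε p => iteratedDeriv k (b ε) (Yf a ε p)) := by
    intro k
    obtain ⟨C, hC⟩ := Zyg1_phi hbz hK' k
    refine ⟨C, ?_⟩
    filter_upwards [hC, ev_Ioc] with ε h hε p hp
    exact h _ ((hKK p hp).2 ε hε)
  induction hf with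
  | base =>
    have := (key 0).mono (phi_mono 0 hrt)
    simpa only [iteratedDeriv_zero] using this
  | @term j k m q hq h =>
    subst h
    exact ((key (j+1)).mul (QQ_bound hs hasmooth haz hc₁ hc₂ hab hK hq)).mono
      (hmain (j+1) k (by omega))
  | add hf hg ihf ihg => exact ihf.add ihg

lemma final {s t r : ℝ} (hs : 0 ≤ s) {a b : ℝ → ℝ → ℝ}
    (hasmooth : ∀ ε ∈ Set.Ioc (0:ℝ) 1, ContDiff ℝ (⊤ : ℕ∞) (a ε)) (haz : ZygLoc1 s a)
    {c₁ c₂ : ℝ} (hc₁ : 0 < c₁) (hc₂ : 0 < c₂)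
    (hab : ∀ ε ∈ Set.Ioc (0:ℝ) 1, ∀ x : ℝ, c₁ ≤ a ε x ∧ a ε x ≤ c₂)
    (hbsmooth : ∀ ε ∈ Set.Ioc (0:ℝ) 1, ContDiff ℝ (⊤ : ℕ∞) (b ε))
    (hbz : ZygLoc1 t b) (hrt : r ≤ t)
    (hmain : ∀ j k : ℕ, 1 ≤ j →
      (fun ε => phi t j ε * psi s k ε) =O[𝓝[>] (0:ℝ)] phi r (j + k)) :
    ZygLoc2 r (ufam a b) := by
  refine Zyg2_of fun K hK α => ?_
  obtain ⟨f, hf, ef⟩ := RR_iter hasmooth hc₁ hc₂ hab hbsmooth (0, 1) (RR.base (a := a) (b := b)) α.2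
  obtain ⟨g, hg, eg⟩ := RR_iter hasmooth hc₁ hc₂ hab hbsmooth (1, 0) hf α.1
  rw [show 0 + α.2 + α.1 = α.1 + α.2 by omega] at hg
  obtain ⟨C, hC⟩ := RR_bound hs hasmooth haz hc₁ hc₂ hab hbz hrt hmain hK hg
  refine ⟨C, ?_⟩
  filter_upwards [hC, ev_Ioc] with ε h hε p hp
  have : mderiv2 α (ufam a b ε) = g ε := by
    rw [← eg ε hε, ← ef ε hε]; rfl
  rw [this]
  exact h p hp

/-- regularity of the solution of the hyperbolic Cauchy problem
`∂_τ u + a(x) ∂_x u = 0`, `u(·,0) = b` with generalized Zygmund-regular coefficient and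
initial datum. -/
theorem hyperbolic_zygLoc (s : ℝ) (hs : 0 ≤ s) (a : ℝ → ℝ → ℝ)
    (hasmooth : ∀ ε ∈ Set.Ioc (0:ℝ) 1, ContDiff ℝ (⊤ : ℕ∞) (a ε))
    (haz : ZygLoc1 s a)
    (c₁ c₂ : ℝ) (hc₁ : 0 < c₁) (hc₁₂ : c₁ ≤ c₂)
    (hab : ∀ ε ∈ Set.Ioc (0:ℝ) 1, ∀ x : ℝ, c₁ ≤ a ε x ∧ a ε x ≤ c₂)
    (t : ℝ) (b : ℝ → ℝ → ℝ)
    (hbsmooth : ∀ ε ∈ Set.Ioc (0:ℝ) 1, ContDiff ℝ (⊤ : ℕ∞) (b ε))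
    (hbz : ZygLoc1 t b) :
    (∀ ε ∈ Set.Ioc (0:ℝ) 1,
      ContDiff ℝ (⊤ : ℕ∞) (Afam a ε) ∧ StrictMono (Afam a ε) ∧ Function.Bijective (Afam a ε) ∧
      ContDiff ℝ (⊤ : ℕ∞) (ufam a b ε) ∧
      (∀ p : ℝ × ℝ,
        fderiv ℝ (ufam a b ε) p (0, 1) + a ε p.1 * fderiv ℝ (ufam a b ε) p (1, 0) = 0) ∧
      (∀ x : ℝ, ufam a b ε (x, 0) = b ε x)) ∧
    (0 < s → ZygLoc2 (min t (s + 1)) (ufam a b)) ∧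
    (s = 0 → ∀ σ > (0:ℝ), ZygLoc2 (min t 1 - σ) (ufam a b)) := by

  have hc₂ : 0 < c₂ := hc₁.trans_le hc₁₂
  refine ⟨fun ε hε => ?_, fun h => ?_, fun h σ hσ => ?_⟩
  · have ha := hasmooth ε hε
    have h1 := hab ε hε
    refine ⟨A_smooth ha hc₁ (fun x => (h1 x).1), A_strict ha hc₁ hc₂ h1, A_bij ha hc₁ hc₂ h1,
      (hbsmooth ε hε).comp (Y_smooth ha hc₁ hc₂ h1), fun p => ?_, fun x => ?_⟩
    · have hp := hc₁.trans_le (h1 p.1).1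
      have hd : HasFDerivAt (ufam a b ε) _ p :=
        (((hbsmooth ε hε).differentiable (by simp) _).hasDerivAt).comp_hasFDerivAt p
          (Y_deriv ha hc₁ hc₂ h1 p)
      rw [hd.fderiv]
      simp
      field_simp
      ring
    · simp only [ufam, sub_zero]
      rw [Function.leftInverse_invFun (A_bij ha hc₁ hc₂ h1).1]
  · exact final hs hasmooth haz hc₁ hc₂ hab hbsmooth hbz (min_le_left _ _)
      (fun j k hj => main1 h j k hj)
  · subst h
    exact final hs hasmooth haz hc₁ hc₂ hab hbsmooth hbz (by linarith [min_le_left t 1])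
      (fun j k hj => main2 hσ j k hj)
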